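/- Let κ, q, c, η, T, σ be real numbers with κ > 0, q > 0, c > 0, η ≥ q², T > 0, and let Q be the explicit Riccati function Q(t) = −(1/2)[κ + q − √Δ ( √Δ sinh(√Δ(T−t)) + (κ+q+c) cosh(√Δ(T−t)) ) / ( √Δ cosh(√Δ(T−t)) + (κ+q+c) sinh(√Δ(T−t)) )] with Δ = (κ+q)² + η − q². Let φ : [0,T] → ℝ be continuous, θ₀ ≥ 0, and let θ : [0,T] → ℝ be differentiable with θ(0) = θ₀ and θ′(t) = −2(κ + φ(t))θ(t) + σ² for all t ∈ [0,T]. Then ∫₀ᵀ ((1/2)φ(t)² − qφ(t) + η/2)·θ(t) dt + (c/2)θ(T) ≥ Q(0)·θ₀ + σ²∫₀ᵀ Q(s) ds. -/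

import Mathlib

/-- The explicit Riccati function of the systemic risk LQ McKean-Vlasov control problem. -/
noncomputable def Qsys (κ q c η T : ℝ) (t : ℝ) : ℝ :=
  -(1/2) * (κ + q - Real.sqrt ((κ + q)^2 + η - q^2) *
    (Real.sqrt ((κ + q)^2 + η - q^2) * Real.sinh (Real.sqrt ((κ + q)^2 + η - q^2) * (T - t))
      + (κ + q + c) * Real.cosh (Real.sqrt ((κ + q)^2 + η - q^2) * (T - t))) /
    (Real.sqrt ((κ + q)^2 + η - q^2) * Real.cosh (Real.sqrt ((κ + q)^2 + η - q^2) * (T - t))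
      + (κ + q + c) * Real.sinh (Real.sqrt ((κ + q)^2 + η - q^2) * (T - t))))

open Set in
/-- A solution of `y' = a y + b` with `b ≥ 0` that starts nonnegative stays nonnegative. -/
theorem nonneg_of_hasDerivAt_linear {T : ℝ} (hT : 0 ≤ T) {a b y : ℝ → ℝ}
    (ha : ContinuousOn a (Icc 0 T)) (hb : ∀ t ∈ Icc 0 T, 0 ≤ b t)
    (hy : ∀ t ∈ Icc 0 T, HasDerivAt y (a t * y t + b t) t) (h0 : 0 ≤ y 0) :
    ∀ t ∈ Icc 0 T, 0 ≤ y t := by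
  let α : ℝ → ℝ := IccExtend hT ((Icc 0 T).domRestrict a)
  have hαc : Continuous α := (continuousOn_iff_continuous_domRestrict.1 ha).Icc_extend'
  have hαa : ∀ t ∈ Icc 0 T, α t = a t := fun t ht => IccExtend_of_mem hT _ ht
  set E : ℝ → ℝ := fun t => Real.exp (-∫ s in (0 : ℝ)..t, α s)
  have hE : ∀ t, HasDerivAt E (E t * -α t) t := fun t =>
    (hαc.integral_hasStrictDerivAt 0 t).hasDerivAt.neg.exp
  have hd : ∀ t ∈ Icc 0 T, HasDerivAt (fun s => y s * E s) (b t * E t) t := by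
    intro t ht
    refine ((hy t ht).mul (hE t)).congr_deriv ?_
    rw [hαa t ht]
    ring
  have hmono : MonotoneOn (fun s => y s * E s) (Icc 0 T) := by
    refine monotoneOn_of_hasDerivWithinAt_nonneg (f' := fun t => b t * E t) (convex_Icc 0 T)
      (fun t ht => (hd t ht).continuousAt.continuousWithinAt)
      (fun t ht => (hd t (interior_subset ht)).hasDerivWithinAt)
      (fun t ht => mul_nonneg (hb t (interior_subset ht)) (Real.exp_pos _).le)
  intro t ht
  have h1 := hmono ⟨le_rfl, hT⟩ ht ht.1
  exact nonneg_of_mul_nonneg_left ((mul_nonneg h0 (Real.exp_pos _).le).trans h1) (Real.exp_pos _)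

theorem Qsys_terminal {κ q c η T : ℝ} (hΔ : 0 < (κ + q)^2 + η - q^2) :
    Qsys κ q c η T T = c / 2 := by
  have hs := (Real.sqrt_pos.2 hΔ).ne'
  simp only [Qsys, sub_self, mul_zero, Real.sinh_zero, Real.cosh_zero]
  field_simp
  ring

theorem hasDerivAt_Qsys {κ q c η T t : ℝ} (hΔ : 0 < (κ + q)^2 + η - q^2)
    (hb : 0 ≤ κ + q + c) (ht : t ≤ T) :
    HasDerivAt (Qsys κ q c η T)
      (2 * (κ + q) * Qsys κ q c η T t + 2 * Qsys κ q c η T t ^ 2 - (η - q^2) / 2) t := by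
  have hs := Real.sqrt_pos.2 hΔ
  have hs2 := Real.sq_sqrt hΔ.le
  unfold Qsys
  set s := Real.sqrt ((κ + q)^2 + η - q^2)
  have hl : HasDerivAt (fun t => s * (T - t)) (-s) t := by
    simpa using ((hasDerivAt_id t).const_sub T).const_mul s
  have hD : 0 < s * Real.cosh (s * (T - t)) + (κ + q + c) * Real.sinh (s * (T - t)) :=
    add_pos_of_pos_of_nonneg (mul_pos hs (Real.cosh_pos _))
      (mul_nonneg hb (Real.sinh_nonneg_iff.2 (mul_nonneg hs.le (sub_nonneg.2 ht))))
  have hη : η = s^2 - (κ + q)^2 + q^2 := by linarith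
  have h := (((((hl.sinh.const_mul s).add (hl.cosh.const_mul (κ + q + c))).const_mul s).div
    ((hl.cosh.const_mul s).add (hl.sinh.const_mul (κ + q + c))) hD.ne').const_sub
      (κ + q)).const_mul (-(1/2))
  refine h.congr_deriv ?_
  simp only [Pi.add_apply]
  generalize Real.cosh (s * (T - t)) = C at *
  generalize Real.sinh (s * (T - t)) = S at *
  rw [hη]
  have hD' := hD.ne'
  field_simp
  ring

theorem stmt6 (κ q c η T σ : ℝ) (hκ : 0 < κ) (hq : 0 < q) (hc : 0 < c)
    (hη : q^2 ≤ η) (hT : 0 < T)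
    (φ : ℝ → ℝ) (hφ : ContinuousOn φ (Set.Icc 0 T))
    (θ₀ : ℝ) (hθ₀ : 0 ≤ θ₀) (θ : ℝ → ℝ) (hθinit : θ 0 = θ₀)
    (hθ' : ∀ t ∈ Set.Icc (0:ℝ) T,
      HasDerivAt θ (-2 * (κ + φ t) * θ t + σ^2) t) :
    Qsys κ q c η T 0 * θ₀ + σ^2 * (∫ s in (0:ℝ)..T, Qsys κ q c η T s) ≤
      (∫ t in (0:ℝ)..T, ((1/2) * (φ t)^2 - q * φ t + η/2) * θ t) + (c/2) * θ T := by
  have hΔ : 0 < (κ + q)^2 + η - q^2 := by nlinarith [pow_pos (add_pos hκ hq) 2]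
  have hu : Set.uIcc 0 T = Set.Icc 0 T := Set.uIcc_of_le hT.le
  have hQ : ∀ t ∈ Set.Icc 0 T, HasDerivAt (Qsys κ q c η T)
      (2 * (κ + q) * Qsys κ q c η T t + 2 * Qsys κ q c η T t ^ 2 - (η - q^2) / 2) t :=
    fun t ht => hasDerivAt_Qsys hΔ (by positivity) ht.2
  have hQT : Qsys κ q c η T T = c / 2 := Qsys_terminal hΔ
  generalize Qsys κ q c η T = Q at *
  have hQc : ContinuousOn Q (Set.Icc 0 T) := fun t ht => (hQ t ht).continuousAt.continuousWithinAt
  have hθc : ContinuousOn θ (Set.Icc 0 T) := fun t ht => (hθ' t ht).continuousAt.continuousWithinAt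
  have hθnn : ∀ t ∈ Set.Icc 0 T, 0 ≤ θ t :=
    nonneg_of_hasDerivAt_linear hT.le (a := fun t => -2 * (κ + φ t)) (b := fun _ => σ^2)
      (by fun_prop) (fun _ _ => sq_nonneg σ) hθ' (hθinit ▸ hθ₀)
  have hf : IntervalIntegrable (fun t => ((1/2) * (φ t)^2 - q * φ t + η/2) * θ t)
      MeasureTheory.volume 0 T :=
    ContinuousOn.intervalIntegrable (by rw [hu]; fun_prop)
  have hσQ : IntervalIntegrable (fun t => σ^2 * Q t) MeasureTheory.volume 0 T :=
    ContinuousOn.intervalIntegrable (by rw [hu]; fun_prop)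
  have hg : IntervalIntegrable (fun t => θ t / 2 * (φ t - q - 2 * Q t)^2)
      MeasureTheory.volume 0 T :=
    ContinuousOn.intervalIntegrable (by rw [hu]; fun_prop)
  have hderiv : ∀ t ∈ Set.uIcc 0 T, HasDerivAt (fun t => Q t * θ t)
      (σ^2 * Q t - ((1/2) * (φ t)^2 - q * φ t + η/2) * θ t
        + θ t / 2 * (φ t - q - 2 * Q t)^2) t := by
    intro t ht
    rw [hu] at ht
    refine ((hQ t ht).mul (hθ' t ht)).congr_deriv ?_
    ring
  have hftc := intervalIntegral.integral_eq_sub_of_hasDerivAt hderiv ((hσQ.sub hf).add hg)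
  rw [intervalIntegral.integral_add (hσQ.sub hf) hg, intervalIntegral.integral_sub hσQ hf,
    intervalIntegral.integral_const_mul, hQT, hθinit] at hftc
  have hnn : 0 ≤ ∫ t in (0 : ℝ)..T, θ t / 2 * (φ t - q - 2 * Q t)^2 :=
    intervalIntegral.integral_nonneg hT.le fun t ht =>
      mul_nonneg (div_nonneg (hθnn t ht) two_pos.le) (sq_nonneg _)
  linarith
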